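/- The functions G₂, G₄, G₆ on the upper half-plane are algebraically independent over ℂ(τ): there is no nonzero polynomial P ∈ ℂ[x₀,x₁,x₂,x₃] with P(τ, G₂(τ), G₄(τ), G₆(τ)) = 0 for all τ in the upper half-plane. -/

import Mathlib

/-- The Eisenstein series `G₄(τ)`. -/
noncomputable def eisenstein4 (τ : ℂ) : ℂ :=
  ∑' p : {p : ℤ × ℤ // p ≠ 0}, 1 / ((p.1.1 : ℂ) + (p.1.2 : ℂ) * τ) ^ 4

/-- The Eisenstein series `G₆(τ)`. -/
noncomputable def eisenstein6 (τ : ℂ) : ℂ :=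
  ∑' p : {p : ℤ × ℤ // p ≠ 0}, 1 / ((p.1.1 : ℂ) + (p.1.2 : ℂ) * τ) ^ 6

/-- The quasi-modular Eisenstein series
`G₂(τ) = 2ζ(2) + 2∑_{n ≥ 1}∑_{m ∈ ℤ} (m + nτ)^{−2}`. -/
noncomputable def eisenstein2 (τ : ℂ) : ℂ :=
  2 * (∑' k : ℕ, (1 : ℂ) / (k + 1) ^ 2) +
    2 * ∑' n : ℕ, ∑' m : ℤ, 1 / ((m : ℂ) + ((n : ℂ) + 1) * τ) ^ 2

open Polynomial in
lemma eval_subst_zero (P : MvPolynomial (Fin 4) ℂ) (a b c d : ℂ[X]) (S : Set ℂ) (hS : S.Infinite)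
    (h : ∀ x ∈ S, MvPolynomial.eval ![a.eval x, b.eval x, c.eval x, d.eval x] P = 0) (x : ℂ) :
    MvPolynomial.eval ![a.eval x, b.eval x, c.eval x, d.eval x] P = 0 := by
  have key : ∀ y : ℂ, (MvPolynomial.aeval ![a, b, c, d] P).eval y
      = MvPolynomial.eval ![a.eval y, b.eval y, c.eval y, d.eval y] P := by
    intro y
    rw [← Polynomial.coe_evalRingHom, MvPolynomial.map_aeval, MvPolynomial.eval,
      MvPolynomial.coe_eval₂Hom]
    congr 1
    · ext z; simp
    · ext i; fin_cases i <;> simp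
  have h0 : MvPolynomial.aeval ![a, b, c, d] P = 0 := by
    apply Polynomial.eq_zero_of_infinite_isRoot
    refine hS.mono fun y hy => ?_
    simp only [Set.mem_ofPred_eq, Polynomial.IsRoot.def]
    rw [key, h y hy]
  rw [← key, h0]; simp

lemma infinite_shift (τ : ℂ) : (Set.range fun n : ℕ => τ + n).Infinite :=
  Set.infinite_range_of_injective fun a b h => by simpa using h

open Polynomial in
theorem core_independence (g2 g4 g6 : ℂ → ℂ)
    (T2 : ∀ τ : ℂ, 0 < τ.im → g2 (τ + 1) = g2 τ)
    (T4 : ∀ τ : ℂ, 0 < τ.im → g4 (τ + 1) = g4 τ)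
    (T6 : ∀ τ : ℂ, 0 < τ.im → g6 (τ + 1) = g6 τ)
    (S2 : ∀ τ : ℂ, 0 < τ.im → g2 (-τ⁻¹) = τ ^ 2 * g2 τ - 2 * Real.pi * Complex.I * τ)
    (S4 : ∀ τ : ℂ, 0 < τ.im → g4 (-τ⁻¹) = τ ^ 4 * g4 τ)
    (S6 : ∀ τ : ℂ, 0 < τ.im → g6 (-τ⁻¹) = τ ^ 6 * g6 τ)
    (hJ : {J : ℂ | ∃ τ : ℂ, 0 < τ.im ∧ g4 τ ≠ 0 ∧ g6 τ ≠ 0 ∧ J = g4 τ ^ 3 / g6 τ ^ 2}.Infinite)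
    (P : MvPolynomial (Fin 4) ℂ)
    (hP : ∀ τ : ℂ, 0 < τ.im → MvPolynomial.eval ![τ, g2 τ, g4 τ, g6 τ] P = 0) : P = 0 := by
  have shift : ∀ (g : ℂ → ℂ), (∀ τ : ℂ, 0 < τ.im → g (τ + 1) = g τ) →
      ∀ (n : ℕ) (τ : ℂ), 0 < τ.im → g (τ + n) = g τ := by
    intro g hg n τ hτ
    induction n with
    | zero => simp
    | succ n ih => push_cast; rw [← add_assoc, hg _ (by simpa using hτ), ih]
  have hS : ∀ τ : ℂ, 0 < τ.im → 0 < (-τ⁻¹).im := fun τ hτ => by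
    have := UpperHalfPlane.im_inv_neg_coe_pos ⟨τ, hτ⟩
    simpa [← inv_neg] using this
  have hne : ∀ τ : ℂ, 0 < τ.im → τ ≠ 0 := by rintro τ hτ rfl; simp at hτ
  have hsn : ∀ (n : ℕ) (τ : ℂ), 0 < τ.im → 0 < (τ + n).im := fun n τ hτ => by simpa using hτ
  -- step 1: free the variable `τ`
  have h1 : ∀ t τ : ℂ, 0 < τ.im → MvPolynomial.eval ![t, g2 τ, g4 τ, g6 τ] P = 0 := by
    intro t τ hτ
    have := eval_subst_zero P X (C (g2 τ)) (C (g4 τ)) (C (g6 τ)) _ (infinite_shift τ) (by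
      rintro _ ⟨n, rfl⟩
      have := hP (τ + n) (hsn n τ hτ)
      rw [shift g2 T2 n τ hτ, shift g4 T4 n τ hτ, shift g6 T6 n τ hτ] at this
      simpa using this) t
    simpa using this
  -- step 2: free the automorphy factor
  have h2 : ∀ t τ u : ℂ, 0 < τ.im →
      MvPolynomial.eval ![t, u ^ 2 * g2 τ - 2 * Real.pi * Complex.I * u,
        u ^ 4 * g4 τ, u ^ 6 * g6 τ] P = 0 := by
    intro t τ u hτ
    have := eval_subst_zero P (C t) (X ^ 2 * C (g2 τ) - C (2 * Real.pi * Complex.I) * X)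
      (X ^ 4 * C (g4 τ)) (X ^ 6 * C (g6 τ)) _ (infinite_shift τ) (by
      rintro _ ⟨n, rfl⟩
      have := h1 t (-(τ + n)⁻¹) (hS _ (hsn n τ hτ))
      rw [S2 _ (hsn n τ hτ), S4 _ (hsn n τ hτ), S6 _ (hsn n τ hτ),
        shift g2 T2 n τ hτ, shift g4 T4 n τ hτ, shift g6 T6 n τ hτ] at this
      simpa only [eval_C, eval_sub, eval_mul, eval_X, eval_pow] using this) u
    simpa only [eval_C, eval_sub, eval_mul, eval_X, eval_pow] using this
  -- step 3: free the quasi-modular variable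
  have h3 : ∀ t s τ v : ℂ, 0 < τ.im → v ≠ 0 → v ≠ -1 →
      MvPolynomial.eval ![t, s, v ^ 4 * g4 τ, v ^ 6 * g6 τ] P = 0 := by
    intro t s τ v hτ hv hv1
    have hv2 : v ^ 2 + v ≠ 0 := by
      intro h
      have : v * (v + 1) = 0 := by linear_combination h
      rcases mul_eq_zero.1 this with h | h
      · exact hv h
      · exact hv1 (by linear_combination h)
    have hpi : (2 * Real.pi * Complex.I : ℂ) ≠ 0 := Complex.two_pi_I_ne_zero
    have hinf : (Set.range fun n : ℕ => (τ + n)⁻¹).Infinite :=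
      Set.infinite_range_of_injective fun a b h => by simpa using h
    have := eval_subst_zero P (C t)
      (C (v ^ 2 * g2 τ) - C (2 * Real.pi * Complex.I * (v ^ 2 + v)) * X)
      (C (v ^ 4 * g4 τ)) (C (v ^ 6 * g6 τ)) _ hinf (by
      rintro _ ⟨n, rfl⟩
      have hz := hne _ (hsn n τ hτ)
      have := h2 t (-(τ + n)⁻¹) (v / (τ + n)) (hS _ (hsn n τ hτ))
      rw [S2 _ (hsn n τ hτ), S4 _ (hsn n τ hτ), S6 _ (hsn n τ hτ),
        shift g2 T2 n τ hτ, shift g4 T4 n τ hτ, shift g6 T6 n τ hτ] at this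
      have e1 : (v / (τ + n)) ^ 2 * ((τ + n) ^ 2 * g2 τ - 2 * Real.pi * Complex.I * (τ + n))
          - 2 * Real.pi * Complex.I * (v / (τ + n))
          = v ^ 2 * g2 τ - 2 * Real.pi * Complex.I * (v ^ 2 + v) * (τ + n)⁻¹ := by
        field_simp
        ring
      have e2 : (v / (τ + n)) ^ 4 * ((τ + n) ^ 4 * g4 τ) = v ^ 4 * g4 τ := by
        field_simp
      have e3 : (v / (τ + n)) ^ 6 * ((τ + n) ^ 6 * g6 τ) = v ^ 6 * g6 τ := by
        field_simp
      rw [e1, e2, e3] at this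
      simpa only [eval_C, eval_sub, eval_mul, eval_X] using this)
      ((v ^ 2 * g2 τ - s) / (2 * Real.pi * Complex.I * (v ^ 2 + v)))
    simp only [eval_C, eval_sub, eval_mul, eval_X] at this
    rwa [mul_div_cancel₀ _ (mul_ne_zero hpi hv2), sub_sub_cancel] at this
  have h3' : ∀ t s τ v : ℂ, 0 < τ.im →
      MvPolynomial.eval ![t, s, v ^ 4 * g4 τ, v ^ 6 * g6 τ] P = 0 := by
    intro t s τ v hτ
    have := eval_subst_zero P (C t) (C s) (X ^ 4 * C (g4 τ)) (X ^ 6 * C (g6 τ)) ({0, -1}ᶜ)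
      (Set.Finite.infinite_compl (by simp)) (by
        intro x hx
        simp only [Set.mem_compl_iff, Set.mem_insert_iff, Set.mem_singleton_iff, not_or] at hx
        simpa only [eval_C, eval_sub, eval_mul, eval_X, eval_pow] using h3 t s τ x hτ hx.1 hx.2) v
    simpa only [eval_C, eval_sub, eval_mul, eval_X, eval_pow] using this
  -- step 4: use the infinitely many values of the invariant
  have h4 : ∀ t s v J : ℂ, MvPolynomial.eval ![t, s, v ^ 2 * J, v ^ 3 * J] P = 0 := by
    intro t s v J
    have := eval_subst_zero P (C t) (C s) (C (v ^ 2) * X) (C (v ^ 3) * X) _ hJ (by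
      rintro _ ⟨τ, hτ, h4, h6, rfl⟩
      obtain ⟨u, hu⟩ := IsAlgClosed.exists_pow_nat_eq (v * g4 τ / g6 τ) (n := 2) (by norm_num)
      have := h3' t s τ u hτ
      have e2 : u ^ 4 * g4 τ = v ^ 2 * (g4 τ ^ 3 / g6 τ ^ 2) := by
        rw [show u ^ 4 = (u ^ 2) ^ 2 by ring, hu]; field_simp
      have e3 : u ^ 6 * g6 τ = v ^ 3 * (g4 τ ^ 3 / g6 τ ^ 2) := by
        rw [show u ^ 6 = (u ^ 2) ^ 3 by ring, hu]; field_simp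
      rw [e2, e3] at this
      simpa only [eval_C, eval_mul, eval_X] using this) J
    simpa only [eval_C, eval_mul, eval_X] using this
  have h5 : ∀ t s y z : ℂ, y ≠ 0 → z ≠ 0 → MvPolynomial.eval ![t, s, y, z] P = 0 := by
    intro t s y z hy hz
    have := h4 t s (z / y) (y ^ 3 / z ^ 2)
    have e2 : (z / y) ^ 2 * (y ^ 3 / z ^ 2) = y := by field_simp
    have e3 : (z / y) ^ 3 * (y ^ 3 / z ^ 2) = z := by field_simp
    rwa [e2, e3] at this
  have h6 : P * (MvPolynomial.X 2 * MvPolynomial.X 3) = 0 := by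
    apply MvPolynomial.funext
    intro x
    have hx : x = ![x 0, x 1, x 2, x 3] := by ext i; fin_cases i <;> rfl
    simp only [map_mul, MvPolynomial.eval_X, map_zero]
    by_cases hy : x 2 = 0
    · simp [hy]
    by_cases hz : x 3 = 0
    · simp [hz]
    rw [hx, h5 _ _ _ _ hy hz, zero_mul]
  simpa [MvPolynomial.X_ne_zero] using h6

open UpperHalfPlane hiding I σ
open EisensteinSeries ModularForm MatrixGroups Filter Topology
open scoped Real ArithmeticFunction.sigma

lemma eisensteinSum_eq (k : ℕ) (hk : 3 ≤ k) (z : ℍ) :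
    ∑' p : {p : ℤ × ℤ // p ≠ 0}, 1 / ((p.1.1 : ℂ) + (p.1.2 : ℂ) * z) ^ k
      = 2 * riemannZeta k * E hk z := by
  have h1 : ∑' p : {p : ℤ × ℤ // p ≠ 0}, 1 / ((p.1.1 : ℂ) + (p.1.2 : ℂ) * z) ^ k
      = ∑' p : ℤ × ℤ, 1 / ((p.1 : ℂ) + (p.2 : ℂ) * z) ^ k := by
    refine tsum_subtype_eq_of_support_subset
      (f := fun p : ℤ × ℤ => 1 / ((p.1 : ℂ) + (p.2 : ℂ) * z) ^ k) (s := {p | p ≠ 0}) ?_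
    intro p hp h0
    apply hp
    rw [h0]
    simp [show k ≠ 0 by omega]
  have h2 : ∑' p : ℤ × ℤ, 1 / ((p.1 : ℂ) + (p.2 : ℂ) * z) ^ k
      = ∑' v : Fin 2 → ℤ, eisSummand k v z := by
    rw [← (finTwoArrowEquiv ℤ).symm.tsum_eq, ← (Equiv.prodComm ℤ ℤ).tsum_eq]
    refine tsum_congr fun p => ?_
    simp [eisSummand, add_comm]
  rw [h1, h2, tsum_eisSummand_eq_riemannZeta_mul_eisensteinSeries hk z,
    show E hk z = (1 / 2 : ℂ) • eisensteinSeriesSIF (N := 1) 0 k z from rfl]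
  simp only [smul_eq_mul, eisensteinSeriesSIF_apply]
  ring

lemma eisenstein4_eq (z : ℍ) : eisenstein4 z = 2 * riemannZeta (4 : ℕ) * E₄ z :=
  eisensteinSum_eq 4 (by norm_num) z

lemma eisenstein6_eq (z : ℍ) : eisenstein6 z = 2 * riemannZeta (6 : ℕ) * E₆ z :=
  eisensteinSum_eq 6 (by norm_num) z

lemma eisenstein2_eq (z : ℍ) : eisenstein2 z = G2 z := by
  rw [G2_eq_tsum_cexp, eisenstein2]
  have h1 : ∑' k : ℕ, (1 : ℂ) / (k + 1) ^ 2 = riemannZeta 2 := by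
    have := zeta_eq_tsum_one_div_nat_add_one_cpow (s := 2) (by norm_num)
    rw [this]
    refine tsum_congr fun n => ?_
    norm_num
  have h2 : ∀ n : ℕ, ∑' m : ℤ, 1 / ((m : ℂ) + ((n : ℂ) + 1) * z) ^ 2
      = -4 * π ^ 2 * ∑' c : ℕ+, (c : ℂ) ^ 1 *
          Complex.exp (2 * π * Complex.I * z) ^ ((n + 1) * c : ℕ) := by
    intro n
    have H2 := qExpansion_identity_pnat (k := 1) le_rfl
      ⟨(n + 1) * z, by
        have : (0 : ℝ) < n + 1 := by positivity
        have h := mul_pos this z.2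
        simpa using h⟩
    have e : ∀ m : ℤ, 1 / ((m : ℂ) + ((n : ℂ) + 1) * z) ^ 2
        = 1 / (((n : ℂ) + 1) * z + m) ^ (1 + 1) := fun m => by rw [add_comm]
    simp_rw [e]
    refine H2.trans ?_
    congr 1
    · simp only [Nat.factorial_one, Nat.cast_one, div_one]
      linear_combination (4 * (π : ℂ) ^ 2) * Complex.I_sq
    · refine tsum_congr fun c => ?_
      rw [← Complex.exp_nat_mul, ← Complex.exp_nat_mul]
      push_cast
      ring_nf
  have h3 := tsum_prod_pow_eq_tsum_sigma 1 (norm_exp_two_pi_I_lt_one z)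
  rw [tsum_pnat_eq_tsum_succ
    (f := fun d ↦ ∑' c : ℕ+, (c : ℂ) ^ 1 * Complex.exp (2 * π * Complex.I * z) ^ (d * c : ℕ))] at h3
  simp_rw [h2, tsum_mul_left]
  rw [h3, h1]
  ring

lemma modularForm_T {k : ℤ} (f : ModularForm 𝒮ℒ k) (z : ℍ) (w : ℍ) (hw : (w : ℂ) = z + 1) :
    f w = f z := by
  have h : (⇑f ∣[k] ModularGroup.T) = ⇑f := f.slash_action_eq' _ ⟨ModularGroup.T, rfl⟩
  have h' := congrFun h z
  have e : w = ModularGroup.T • z := by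
    rw [modular_T_smul]
    ext1
    rw [hw, UpperHalfPlane.coe_vadd]; simp [add_comm]
  rw [SL_slash_apply, ← e, ModularGroup.denom_apply] at h'
  simpa [ModularGroup.T] using h'

lemma modularForm_S {k : ℤ} (f : ModularForm 𝒮ℒ k) (z : ℍ) (w : ℍ) (hw : (w : ℂ) = -(z : ℂ)⁻¹) :
    f w = (z : ℂ) ^ k * f z := by
  have h : (⇑f ∣[k] ModularGroup.S) = ⇑f := f.slash_action_eq' _ ⟨ModularGroup.S, rfl⟩
  have h' := congrFun h z
  have e : w = ModularGroup.S • z := by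
    rw [modular_S_smul]
    ext1
    rw [hw]; simp [inv_neg]
  rw [SL_slash_apply, ← e, ModularGroup.denom_apply] at h'
  have hz : (z : ℂ) ^ k ≠ 0 := zpow_ne_zero _ z.ne_zero
  have h2 : f w * ((z : ℂ) ^ k)⁻¹ = f z := by
    simpa [ModularGroup.S] using h'
  rw [← h2]
  field_simp

lemma E_tendsto {k : ℕ} (hk : 3 ≤ k) (hk2 : Even k) : Tendsto (E hk) atImInfty (𝓝 1) := by
  have h := ModularFormClass.exp_decay_sub_atImInfty' (E hk)
  obtain ⟨c, hc, hO⟩ := h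
  have hv : valueAtInfty (E hk) = 1 := by
    rw [← E_qExpansion_coeff_zero hk hk2, qExpansion_coeff_zero one_pos
      (ModularFormClass.analyticAt_cuspFunction_zero _ one_pos one_mem_strictPeriods_SL)
      (SlashInvariantFormClass.periodic_comp_ofComplex _ one_mem_strictPeriods_SL)]
  rw [hv] at hO
  have h0 : Tendsto (fun τ : ℍ => Real.exp (-c * τ.im)) atImInfty (𝓝 0) := by
    apply Real.tendsto_exp_atBot.comp
    exact tendsto_comap.const_mul_atTop_of_neg (by linarith)
  have := (hO.trans_tendsto h0).add_const 1
  simpa using this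

lemma J_infinite : {J : ℂ | ∃ τ : ℂ, 0 < τ.im ∧ eisenstein4 τ ≠ 0 ∧ eisenstein6 τ ≠ 0 ∧
    J = eisenstein4 τ ^ 3 / eisenstein6 τ ^ 2}.Infinite := by
  have z4 : (2 * riemannZeta (4 : ℕ) : ℂ) ≠ 0 :=
    mul_ne_zero two_ne_zero (riemannZeta_ne_zero_of_one_lt_re (by norm_num))
  have z6 : (2 * riemannZeta (6 : ℕ) : ℂ) ≠ 0 :=
    mul_ne_zero two_ne_zero (riemannZeta_ne_zero_of_one_lt_re (by norm_num))
  have t4 := E_tendsto (k := 4) (by norm_num) (by decide)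
  have t6 := E_tendsto (k := 6) (by norm_num) (by decide)
  set a := 2 * riemannZeta (4 : ℕ) with ha
  set b := 2 * riemannZeta (6 : ℕ) with hb
  intro hfin
  have lim : Tendsto (fun z : ℍ => eisenstein4 z ^ 3 / eisenstein6 z ^ 2) atImInfty
      (𝓝 (a ^ 3 / b ^ 2)) := by
    have := ((t4.const_mul a).pow 3).div ((t6.const_mul b).pow 2) (by simpa using z6)
    simp only [mul_one] at this
    refine this.congr fun z => ?_
    rw [eisenstein4_eq, eisenstein6_eq]
    rfl
  have ev : ∀ᶠ z : ℍ in atImInfty, E₄ z ≠ 0 ∧ E₆ z ≠ 0 :=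
    (t4.eventually_ne one_ne_zero).and (t6.eventually_ne one_ne_zero)
  have mem := hfin.isClosed.mem_of_tendsto lim (by
    filter_upwards [ev] with z hz
    refine ⟨z, z.2, ?_, ?_, rfl⟩
    · rw [eisenstein4_eq]; exact mul_ne_zero z4 hz.1
    · rw [eisenstein6_eq]; exact mul_ne_zero z6 hz.2)
  obtain ⟨τ, hτ, h4, h6, hJ⟩ := mem
  have d := discriminant_eq_E₄_cube_sub_E₆_sq ⟨τ, hτ⟩
  have d0 := discriminant_ne_zero ⟨τ, hτ⟩
  have e4 := eisenstein4_eq ⟨τ, hτ⟩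
  have e6 := eisenstein6_eq ⟨τ, hτ⟩
  simp only at e4 e6
  rw [e6] at h6
  have h6' := right_ne_zero_of_mul h6
  rw [e4, e6] at hJ
  apply d0
  rw [d]
  rw [← ha, ← hb] at hJ
  have : E₄ ⟨τ, hτ⟩ ^ 3 = E₆ ⟨τ, hτ⟩ ^ 2 := by
    field_simp at hJ
    exact hJ.symm
  rw [this]; simp

/-- The functions `G₂`, `G₄`, `G₆` are algebraically independent over `ℂ(τ)`:
no nonzero `P ∈ ℂ[x₀,x₁,x₂,x₃]` satisfies `P(τ, G₂(τ), G₄(τ), G₆(τ)) = 0` on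
the upper half-plane. -/
theorem eisenstein2_4_6_algebraically_independent :
    ¬ ∃ P : MvPolynomial (Fin 4) ℂ, P ≠ 0 ∧
      ∀ τ : ℂ, 0 < τ.im →
        MvPolynomial.eval ![τ, eisenstein2 τ, eisenstein4 τ, eisenstein6 τ] P = 0 := by
  rintro ⟨P, hP0, hP⟩
  apply hP0
  have hS : ∀ τ : ℂ, 0 < τ.im → 0 < (-τ⁻¹).im := fun τ hτ => by
    have := UpperHalfPlane.im_inv_neg_coe_pos ⟨τ, hτ⟩
    simpa [← inv_neg] using this
  have hT : ∀ τ : ℂ, 0 < τ.im → 0 < (τ + 1).im := fun τ hτ => by simpa using hτ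
  refine core_independence eisenstein2 eisenstein4 eisenstein6 ?_ ?_ ?_ ?_ ?_ ?_ J_infinite P hP
  · intro τ hτ
    have a1 := eisenstein2_eq ⟨τ, hτ⟩
    have a2 := eisenstein2_eq ⟨τ + 1, hT τ hτ⟩
    simp only at a1 a2
    rw [a1, a2, G2_eq_tsum_cexp, G2_eq_tsum_cexp]
    simp only [mul_add, mul_one, Complex.exp_periodic _]
  · intro τ hτ
    have a1 := eisenstein4_eq ⟨τ, hτ⟩
    have a2 := eisenstein4_eq ⟨τ + 1, hT τ hτ⟩
    simp only at a1 a2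
    rw [a1, a2, modularForm_T E₄ ⟨τ, hτ⟩ ⟨τ + 1, hT τ hτ⟩ rfl]
  · intro τ hτ
    have a1 := eisenstein6_eq ⟨τ, hτ⟩
    have a2 := eisenstein6_eq ⟨τ + 1, hT τ hτ⟩
    simp only at a1 a2
    rw [a1, a2, modularForm_T E₆ ⟨τ, hτ⟩ ⟨τ + 1, hT τ hτ⟩ rfl]
  · intro τ hτ
    have a1 := eisenstein2_eq ⟨τ, hτ⟩
    have a2 := eisenstein2_eq ⟨-τ⁻¹, hS τ hτ⟩
    simp only at a1 a2
    have h := G2_S_transform ⟨τ, hτ⟩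
    have hne : τ ≠ 0 := by rintro rfl; simp at hτ
    have e : ModularGroup.S • (⟨τ, hτ⟩ : ℍ) = ⟨-τ⁻¹, hS τ hτ⟩ := by
      rw [modular_S_smul]; ext1; simp [inv_neg]
    rw [e, ← a1, ← a2] at h
    rw [h]
    simp only
    field_simp
    ring
  · intro τ hτ
    have a1 := eisenstein4_eq ⟨τ, hτ⟩
    have a2 := eisenstein4_eq ⟨-τ⁻¹, hS τ hτ⟩
    simp only at a1 a2
    rw [a1, a2, modularForm_S E₄ ⟨τ, hτ⟩ ⟨-τ⁻¹, hS τ hτ⟩ rfl]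
    simp only
    norm_cast
    ring
  · intro τ hτ
    have a1 := eisenstein6_eq ⟨τ, hτ⟩
    have a2 := eisenstein6_eq ⟨-τ⁻¹, hS τ hτ⟩
    simp only at a1 a2
    rw [a1, a2, modularForm_S E₆ ⟨τ, hτ⟩ ⟨-τ⁻¹, hS τ hτ⟩ rfl]
    simp only
    norm_cast
    ring
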